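/- Let a_1, a_2, a_3, a_4 be real polynomials, μ ∈ ℝ, and let p be a real polynomial of degree N whose N zeros x_1,…,x_N are real and pairwise distinct, satisfying a_4 p'''' + a_3 p''' + a_2 p'' + a_1 p' = μ p. Form the Lagrange basis polynomials ℓ_n with respect to the nodes x_1,…,x_N. Then for all m ≠ n (1 ≤ m, n ≤ N), with A_{mn} := 1/(x_m − x_n): a_4(x_m) ℓ_n''''(x_m) + a_3(x_m) ℓ_n'''(x_m) + a_2(x_m) ℓ_n''(x_m) + a_1(x_m) ℓ_n'(x_m) = −((A_{mn})²/p'(x_n)) · { 4a_4(x_m) p'''(x_m) + 3[a_3(x_m) − 4a_4(x_m)A_{mn}] p''(x_m) − 2[3A_{mn}(a_3(x_m) − 4a_4(x_m)A_{mn}) − a_2(x_m)] p'(x_m) }. -/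

import Mathlib

open Polynomial Finset

/-- The Lagrange interpolation basis polynomial `ℓ_j` with respect to the nodes `x`,
i.e. `ℓ_j(t) = ψ(t)/(ψ'(x_j)(t - x_j)) = ∏_{k ≠ j} (t - x_k)/(x_j - x_k)`. -/
noncomputable def lag {N : ℕ} (x : Fin N → ℝ) (j : Fin N) : Polynomial ℝ :=
  ∏ k ∈ Finset.univ.erase j, Polynomial.C (x j - x k)⁻¹ * (Polynomial.X - Polynomial.C (x k))

/-- `dvl q k t` is the `k`-th derivative of the polynomial `q`, evaluated at `t`. -/
noncomputable def dvl (q : Polynomial ℝ) (k : ℕ) (t : ℝ) : ℝ :=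
  (Polynomial.derivative^[k] q).eval t

theorem lag_eval_self {N : ℕ} {x : Fin N → ℝ} (hx : Function.Injective x) (n : Fin N) :
    (lag x n).eval (x n) = 1 := by
  rw [lag, eval_prod]
  refine Finset.prod_eq_one fun k hk => ?_
  have hne : x n - x k ≠ 0 := sub_ne_zero.mpr (hx.ne (Finset.ne_of_mem_erase hk).symm)
  simp [hne]

theorem lag_eval_of_ne {N : ℕ} (x : Fin N → ℝ) {m n : Fin N} (h : m ≠ n) :
    (lag x n).eval (x m) = 0 := by
  rw [lag, eval_prod]
  exact Finset.prod_eq_zero (Finset.mem_erase.mpr ⟨h, Finset.mem_univ m⟩) (by simp)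

/-- A polynomial of degree `N` vanishing at `N` distinct nodes factors through every Lagrange
basis polynomial, the constant being its derivative at the corresponding node. -/
theorem eq_sub_mul_lag {N : ℕ} {p : Polynomial ℝ} (hp : p.degree = (N : WithBot ℕ))
    {x : Fin N → ℝ} (hx : Function.Injective x) (hzero : ∀ n : Fin N, p.eval (x n) = 0)
    (n : Fin N) :
    dvl p 1 (x n) ≠ 0 ∧ p = (X - C (x n)) * (C (dvl p 1 (x n)) * lag x n) := by
  have hp0 : p ≠ 0 := by rintro rfl; simp at hp
  have hdvd : ∏ k : Fin N, (X - C (x k)) ∣ p :=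
    Finset.prod_dvd_of_coprime
      ((pairwise_coprime_X_sub_C hx).set_pairwise _)
      fun k _ => dvd_iff_isRoot.mpr (hzero k)
  have hlag : (X - C (x n)) * lag x n =
      C (∏ k ∈ Finset.univ.erase n, (x n - x k)⁻¹) * ∏ k : Fin N, (X - C (x k)) := by
    rw [lag, Finset.prod_mul_distrib, ← map_prod,
      ← Finset.mul_prod_erase Finset.univ (fun k => X - C (x k)) (Finset.mem_univ n)]
    ring
  have hb : ∏ k ∈ Finset.univ.erase n, (x n - x k)⁻¹ ≠ 0 :=
    Finset.prod_ne_zero_iff.mpr fun k hk =>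
      inv_ne_zero (sub_ne_zero.mpr (hx.ne (Finset.ne_of_mem_erase hk).symm))
  set b := ∏ k ∈ Finset.univ.erase n, (x n - x k)⁻¹
  obtain ⟨q, hq⟩ := hdvd
  have hdeg : (∏ k : Fin N, (X - C (x k))).degree = (N : WithBot ℕ) := by
    simp [degree_prod]
  have hq0 : q.degree = 0 := by
    have hne : q ≠ 0 := by rintro rfl; simp [hp0] at hq
    have h := congrArg degree hq
    rw [degree_mul, hp, hdeg, degree_eq_natDegree hne] at h
    rw [degree_eq_natDegree hne]
    norm_cast at h ⊢
    omega
  obtain ⟨a, ha⟩ : ∃ a, q = C a := ⟨_, eq_C_of_degree_eq_zero hq0⟩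
  have hfac : p = (X - C (x n)) * (C (a / b) * lag x n) := by
    have hab : C (a / b) * C b = (C a : Polynomial ℝ) := by
      rw [← C_mul, div_mul_cancel₀ a hb]
    rw [mul_left_comm, hlag, ← mul_assoc, hab, hq, ha, mul_comm]
  have hc : dvl p 1 (x n) = a / b := by
    rw [hfac]
    simp [dvl, lag_eval_self hx]
  refine ⟨?_, hc ▸ hfac⟩
  intro h0
  rw [← hc, h0] at hfac
  simp [hp0] at hfac

theorem dvl_sub_mul_C_mul (c y t : ℝ) (q : Polynomial ℝ) (k : ℕ) :
    dvl ((X - C y) * (C c * q)) (k + 1) t =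
      c * ((t - y) * dvl q (k + 1) t + (k + 1) * dvl q k t) := by
  have h : ∀ k : ℕ, derivative^[k + 1] ((X - C y) * (C c * q)) =
      C c * ((X - C y) * derivative^[k + 1] q + ((k : ℝ[X]) + 1) * derivative^[k] q) := by
    intro k
    induction k with
    | zero =>
      simp
      ring
    | succ k ih =>
      rw [Function.iterate_succ_apply', ih, Function.iterate_succ_apply' _ (k + 1) q,
        Function.iterate_succ_apply' _ k q]
      simp only [derivative_mul, derivative_add, derivative_sub, derivative_C, derivative_X,
        derivative_natCast, derivative_one, Nat.cast_add, Nat.cast_one]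
      ring
  simp only [dvl, h]
  simp

theorem stmt19
    (a₁ a₂ a₃ a₄ : Polynomial ℝ) (μ : ℝ)
    (N : ℕ) (p : Polynomial ℝ) (hp : p.degree = (N : WithBot ℕ))
    (x : Fin N → ℝ) (hx : Function.Injective x)
    (hzero : ∀ n : Fin N, p.eval (x n) = 0)
    (hODE : a₄ * Polynomial.derivative^[4] p + a₃ * Polynomial.derivative^[3] p +
        a₂ * Polynomial.derivative^[2] p + a₁ * Polynomial.derivative p =
      Polynomial.C μ * p) :
    ∀ m n : Fin N, m ≠ n →
      a₄.eval (x m) * dvl (lag x n) 4 (x m) + a₃.eval (x m) * dvl (lag x n) 3 (x m)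
        + a₂.eval (x m) * dvl (lag x n) 2 (x m) + a₁.eval (x m) * dvl (lag x n) 1 (x m) =
      -(((x m - x n)⁻¹) ^ 2 / dvl p 1 (x n)) *
        (4 * a₄.eval (x m) * dvl p 3 (x m)
          + 3 * (a₃.eval (x m) - 4 * a₄.eval (x m) * (x m - x n)⁻¹) * dvl p 2 (x m)
          - 2 * (3 * (x m - x n)⁻¹ *
              (a₃.eval (x m) - 4 * a₄.eval (x m) * (x m - x n)⁻¹) - a₂.eval (x m)) *
              dvl p 1 (x m)) := by
  intro m n hmn
  obtain ⟨hc, hfac⟩ := eq_sub_mul_lag hp hx hzero n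
  have hd : x m - x n ≠ 0 := sub_ne_zero.mpr (hx.ne hmn)
  have hrec : ∀ k : ℕ, dvl p (k + 1) (x m) = dvl p 1 (x n) *
      ((x m - x n) * dvl (lag x n) (k + 1) (x m) + (k + 1) * dvl (lag x n) k (x m)) := by
    intro k
    conv_lhs => rw [hfac]
    exact dvl_sub_mul_C_mul _ _ _ _ k
  have h0 : dvl (lag x n) 0 (x m) = 0 := lag_eval_of_ne x hmn
  have h1 := hrec 0
  have h2 := hrec 1
  have h3 := hrec 2
  have h4 := hrec 3
  have hode := congrArg (eval (x m)) hODE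
  simp only [eval_add, eval_mul, hzero m, mul_zero] at hode
  change a₄.eval (x m) * dvl p 4 (x m) + a₃.eval (x m) * dvl p 3 (x m) +
    a₂.eval (x m) * dvl p 2 (x m) + a₁.eval (x m) * dvl p 1 (x m) = 0 at hode
  norm_num [h0] at h1 h2 h3 h4
  rw [h1, h2, h3, h4] at hode
  rw [h1, h2, h3]
  generalize dvl p 1 (x n) = c at *
  generalize x m - x n = d at *
  field_simp
  apply mul_left_cancel₀ hc
  linear_combination d ^ 2 * hode
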